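/- Let A be a real m×k matrix with AᵀA invertible, let y ∈ ℝᵐ, and let x̂ = (AᵀA)⁻¹Aᵀy be the least-squares estimate. Then for each index i ∈ {1,…,k}, writing A∖i for A with its i-th column deleted and aᵢ for the i-th column of A, the matrix (A∖i)ᵀ(A∖i) is invertible, R_{A∖i} aᵢ ≠ 0, and x̂(i) = ⟨R_{A∖i} aᵢ, y⟩ / ‖R_{A∖i} aᵢ‖². -/

import Mathlib

open Matrix

noncomputable section

/-- `P_A = A (AᵀA)⁻¹ Aᵀ`, the orthogonal projection onto the column span of `A`. -/
def proj {m : ℕ} {ι : Type} [Fintype ι] [DecidableEq ι]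
    (A : Matrix (Fin m) ι ℝ) : Matrix (Fin m) (Fin m) ℝ :=
  A * (Aᵀ * A)⁻¹ * Aᵀ

/-- `R_A = I − P_A`. -/
def resid {m : ℕ} {ι : Type} [Fintype ι] [DecidableEq ι]
    (A : Matrix (Fin m) ι ℝ) : Matrix (Fin m) (Fin m) ℝ :=
  1 - proj A

/-- `A` with its `i`-th column deleted. -/
def delCol {m k : ℕ} (A : Matrix (Fin m) (Fin k) ℝ) (i : Fin k) :
    Matrix (Fin m) {j : Fin k // j ≠ i} ℝ :=
  A.submatrix id fun j => (j : Fin k)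

/-- A real matrix with invertible Gram matrix acts injectively on vectors, and conversely. -/
theorem isUnit_transpose_mul_self_iff {m ι : Type*} [Fintype m] [Fintype ι] [DecidableEq ι]
    (A : Matrix m ι ℝ) : IsUnit (Aᵀ * A) ↔ ∀ v, A *ᵥ v = 0 → v = 0 := by
  have key : ∀ v, (Aᵀ * A) *ᵥ v = 0 ↔ A *ᵥ v = 0 := fun v =>
    SetLike.ext_iff.1 (ker_mulVecLin_transpose_mul_self A) v
  rw [← mulVec_injective_iff_isUnit, ← coe_mulVecLin, injective_iff_map_eq_zero]
  simp only [mulVecLin_apply, key]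

/-- Splitting off the `i`-th column in a matrix-vector product. -/
theorem mulVec_eq_delCol_add {m k : ℕ} (A : Matrix (Fin m) (Fin k) ℝ) (i : Fin k)
    (x : Fin k → ℝ) :
    A *ᵥ x = delCol A i *ᵥ (fun j => x j) + x i • fun r => A r i := by
  ext r
  simp only [mulVec, dotProduct, delCol, submatrix_apply, id, Pi.add_apply, Pi.smul_apply,
    smul_eq_mul]
  rw [Fintype.sum_eq_add_sum_subtype_ne _ i]
  ring

/-- The residual of a vector is orthogonal to the columns of the matrix. -/
theorem transpose_mulVec_resid {m : ℕ} {ι : Type} [Fintype ι] [DecidableEq ι]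
    (B : Matrix (Fin m) ι ℝ) (hB : IsUnit (Bᵀ * B)) (a : Fin m → ℝ) :
    Bᵀ *ᵥ (resid B *ᵥ a) = 0 := by
  have h : Bᵀ * resid B = 0 := by
    rw [resid, proj, Matrix.mul_sub, Matrix.mul_one, ← Matrix.mul_assoc, ← Matrix.mul_assoc,
      mul_nonsing_inv _ ((isUnit_iff_isUnit_det _).1 hB), Matrix.one_mul, sub_self]
  rw [mulVec_mulVec, h, zero_mulVec]

/-- The value of the `i`-th entry of the least squares estimate. -/
theorem stmt3 {m k : ℕ} (A : Matrix (Fin m) (Fin k) ℝ) (hA : IsUnit (Aᵀ * A))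
    (y : Fin m → ℝ) (xhat : Fin k → ℝ) (hx : xhat = (Aᵀ * A)⁻¹ *ᵥ (Aᵀ *ᵥ y))
    (i : Fin k) :
    IsUnit ((delCol A i)ᵀ * delCol A i) ∧
      (resid (delCol A i) *ᵥ fun r => A r i) ≠ 0 ∧
      xhat i =
        ((resid (delCol A i) *ᵥ fun r => A r i) ⬝ᵥ y) /
          ((resid (delCol A i) *ᵥ fun r => A r i) ⬝ᵥ
            (resid (delCol A i) *ᵥ fun r => A r i)) := by
  set B := delCol A i with hBdef
  set a : Fin m → ℝ := fun r => A r i with ha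
  have hinj := (isUnit_transpose_mul_self_iff A).1 hA
  have hB : IsUnit (Bᵀ * B) := by
    refine (isUnit_transpose_mul_self_iff B).2 fun w hw => ?_
    have h0 := hinj (fun j => if h : j ≠ i then w ⟨j, h⟩ else 0) (by
      have hres : (fun j : {j : Fin k // j ≠ i} =>
          if h : (j : Fin k) ≠ i then w ⟨j, h⟩ else 0) = w := by
        ext j
        simp [j.2]
      rw [mulVec_eq_delCol_add A i, hres]
      simpa using hw)
    ext j
    simpa [j.2] using congrFun h0 j
  set r := resid B *ᵥ a with hr
  set c := (Bᵀ * B)⁻¹ *ᵥ (Bᵀ *ᵥ a) with hc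
  have hra : r = a - B *ᵥ c := by
    simp [hr, hc, resid, proj, sub_mulVec, mulVec_mulVec, Matrix.mul_assoc]
  have horth : ∀ w, r ⬝ᵥ B *ᵥ w = 0 := fun w => by
    rw [dotProduct_mulVec, ← mulVec_transpose, transpose_mulVec_resid B hB, zero_dotProduct]
  obtain ⟨v, hvi, hv⟩ : ∃ v : Fin k → ℝ, v i = 1 ∧ A *ᵥ v = r := by
    refine ⟨fun j => if h : j ≠ i then -c ⟨j, h⟩ else 1, by simp, ?_⟩
    have hneg : (fun j : {j : Fin k // j ≠ i} =>
        if h : (j : Fin k) ≠ i then -c ⟨j, h⟩ else 1) = -c := by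
      ext j
      simp [j.2]
    rw [mulVec_eq_delCol_add A i, hneg, hra, mulVec_neg]
    simp [← hBdef, ← ha, sub_eq_neg_add]
  have hr0 : r ≠ 0 := fun h => by
    have := congrFun (hinj v (hv.trans h)) i
    simp [hvi] at this
  refine ⟨hB, hr0, ?_⟩
  have hrr : r ⬝ᵥ a = r ⬝ᵥ r := by
    conv_rhs => rw [hra, dotProduct_sub, ← hra, horth, sub_zero]
  have hnormal : Aᵀ *ᵥ (A *ᵥ xhat) = Aᵀ *ᵥ y := by
    rw [hx, mulVec_mulVec, mulVec_mulVec,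
      mul_nonsing_inv _ ((isUnit_iff_isUnit_det _).1 hA), one_mulVec]
  have hry : r ⬝ᵥ y = xhat i * (r ⬝ᵥ r) := by
    calc r ⬝ᵥ y = r ⬝ᵥ A *ᵥ xhat := by
          rw [← hv, ← vecMul_transpose, ← dotProduct_mulVec, ← dotProduct_mulVec, hnormal]
      _ = xhat i * (r ⬝ᵥ r) := by
          rw [mulVec_eq_delCol_add A i, dotProduct_add, horth, dotProduct_smul, hrr, zero_add,
            smul_eq_mul]
  rw [hry, mul_div_cancel_right₀ _ (mt dotProduct_self_eq_zero.1 hr0)]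

end
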